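/- Let λ > 0 and γ ≥ 0. The function w_M is continuous on [0, π] and twice differentiable on (0, π); it satisfies w_M(0) = 1, (1/2)·w_M''(x) = γ·w_M(x) for all x ∈ (0, π/2), (1/2)·w_M''(x) + 2λ·(w_M(π−x) − w_M(x)) = γ·w_M(x) for all x ∈ (π/2, π), and the left derivative of w_M at x = π equals 0. -/

import Mathlib

open Real Set

noncomputable def alph (lam gam : ℝ) : ℝ := Real.sqrt (2 * (2 * lam + gam))

noncomputable def bet (gam : ℝ) : ℝ := Real.sqrt (2 * gam)

noncomputable def kappa1 (lam gam : ℝ) : ℝ :=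
  2 * Real.cosh (alph lam gam * (π / 2)) * Real.sinh (bet gam * (π / 2)) /
    (2 * Real.cosh (alph lam gam * (π / 2)) * Real.cosh (bet gam * (π / 2)) - 1)

noncomputable def kappa2 (lam gam : ℝ) : ℝ :=
  (bet gam / alph lam gam) * kappa1 lam gam * (1 / Real.cosh (alph lam gam * (π / 2)))

noncomputable def wM (lam gam : ℝ) (x : ℝ) : ℝ :=
  if x ≤ π / 2 then
    Real.cosh (bet gam * x) - kappa1 lam gam * Real.sinh (bet gam * x)
  else
    (Real.cosh (bet gam * (π - x)) - kappa1 lam gam * Real.sinh (bet gam * (π - x)))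
      - kappa2 lam gam * Real.sinh (alph lam gam * (x - π / 2))

theorem glue_deriv (f g f' g' : ℝ → ℝ) (c : ℝ) (hf : ∀ x, HasDerivAt f (f' x) x)
    (hg : ∀ x, HasDerivAt g (g' x) x) (h0 : f c = g c) (h1 : f' c = g' c) (x : ℝ) :
    HasDerivAt (fun y => if y ≤ c then f y else g y) (if x ≤ c then f' x else g' x) x := by
  rcases lt_trichotomy x c with h | h | h
  · rw [if_pos h.le]
    refine (hf x).congr_of_eventuallyEq ?_
    filter_upwards [Iio_mem_nhds h] with y hy
    exact if_pos (le_of_lt hy)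
  · subst h
    rw [if_pos le_rfl]
    have hl : HasDerivWithinAt (fun y => if y ≤ x then f y else g y) (f' x) (Iic x) x := by
      refine (hf x).hasDerivWithinAt.congr (fun y hy => if_pos hy) (if_pos le_rfl)
    have hr : HasDerivWithinAt (fun y => if y ≤ x then f y else g y) (f' x) (Ici x) x := by
      rw [h1]
      refine (hg x).hasDerivWithinAt.congr (fun y hy => ?_) ?_
      · rcases eq_or_lt_of_le (show x ≤ y from hy) with e | e
        · subst e; simp [h0]
        · exact if_neg (not_le.mpr e)
      · simp [h0]
    have := hl.union hr
    rwa [Iic_union_Ici, hasDerivWithinAt_univ] at this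
  · rw [if_neg (not_le.mpr h)]
    refine (hg x).congr_of_eventuallyEq ?_
    filter_upwards [Ioi_mem_nhds h] with y hy
    exact if_neg (not_le.mpr hy)

theorem hd_left (b k : ℝ) (x : ℝ) :
    HasDerivAt (fun x => cosh (b * x) - k * sinh (b * x))
      (b * (sinh (b * x) - k * cosh (b * x))) x := by
  have hb : HasDerivAt (fun x : ℝ => b * x) b x := by
    simpa using (hasDerivAt_id x).const_mul b
  exact (hb.cosh.sub (hb.sinh.const_mul k)).congr_deriv (by ring)

theorem hd_left2 (b k : ℝ) (x : ℝ) :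
    HasDerivAt (fun x => b * (sinh (b * x) - k * cosh (b * x)))
      (b ^ 2 * (cosh (b * x) - k * sinh (b * x))) x := by
  have hb : HasDerivAt (fun x : ℝ => b * x) b x := by
    simpa using (hasDerivAt_id x).const_mul b
  exact ((hb.sinh.sub (hb.cosh.const_mul k)).const_mul b).congr_deriv (by ring)

theorem hd_right (a b k m : ℝ) (x : ℝ) :
    HasDerivAt (fun x => (cosh (b * (π - x)) - k * sinh (b * (π - x))) - m * sinh (a * (x - π / 2)))
      (-(b * (sinh (b * (π - x)) - k * cosh (b * (π - x)))) - m * a * cosh (a * (x - π / 2))) x := by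
  have h1 : HasDerivAt (fun x : ℝ => π - x) (-1) x := by
    simpa using (hasDerivAt_id x).const_sub π
  have h2 : HasDerivAt (fun x : ℝ => a * (x - π / 2)) a x := by
    simpa using ((hasDerivAt_id x).sub_const (π / 2)).const_mul a
  exact (((hd_left b k (π - x)).comp x h1).sub (h2.sinh.const_mul m)).congr_deriv (by ring)

theorem hd_right2 (a b k m : ℝ) (x : ℝ) :
    HasDerivAt (fun x => -(b * (sinh (b * (π - x)) - k * cosh (b * (π - x))))
        - m * a * cosh (a * (x - π / 2)))
      (b ^ 2 * (cosh (b * (π - x)) - k * sinh (b * (π - x)))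
        - m * a ^ 2 * sinh (a * (x - π / 2))) x := by
  have h1 : HasDerivAt (fun x : ℝ => π - x) (-1) x := by
    simpa using (hasDerivAt_id x).const_sub π
  have h2 : HasDerivAt (fun x : ℝ => a * (x - π / 2)) a x := by
    simpa using ((hasDerivAt_id x).sub_const (π / 2)).const_mul a
  exact (((hd_left2 b k (π - x)).comp x h1).neg.sub (h2.cosh.const_mul (m * a))).congr_deriv (by ring)

/-- For `λ > 0` and `γ ≥ 0`: `w_M` is continuous on `[0, π]` and twice differentiable on
`(0, π)`; `w_M(0) = 1`; `(1/2) w_M'' = γ w_M` on `(0, π/2)`;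
`(1/2) w_M''(x) + 2λ (w_M(π−x) − w_M(x)) = γ w_M(x)` on `(π/2, π)`; and the left
derivative of `w_M` at `π` is `0`. -/
theorem stmt10 (lam gam : ℝ) (hlam : 0 < lam) (hgam : 0 ≤ gam) :
    ContinuousOn (wM lam gam) (Icc 0 π) ∧
    (∀ x ∈ Ioo (0 : ℝ) π,
      DifferentiableAt ℝ (wM lam gam) x ∧ DifferentiableAt ℝ (deriv (wM lam gam)) x) ∧
    wM lam gam 0 = 1 ∧
    (∀ x ∈ Ioo (0 : ℝ) (π / 2),
      (1 / 2) * deriv (deriv (wM lam gam)) x = gam * wM lam gam x) ∧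
    (∀ x ∈ Ioo (π / 2) π,
      (1 / 2) * deriv (deriv (wM lam gam)) x
        + 2 * lam * (wM lam gam (π - x) - wM lam gam x) = gam * wM lam gam x) ∧
    HasDerivWithinAt (wM lam gam) 0 (Iic π) π := by
  have ha2 : alph lam gam ^ 2 = 2 * (2 * lam + gam) := Real.sq_sqrt (by positivity)
  have hb2 : bet gam ^ 2 = 2 * gam := Real.sq_sqrt (by positivity)
  have ha : alph lam gam ≠ 0 := (Real.sqrt_pos.mpr (by positivity)).ne'
  have hCa := Real.one_le_cosh (alph lam gam * (π / 2))
  have hCb := Real.one_le_cosh (bet gam * (π / 2))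
  have hden : 2 * cosh (alph lam gam * (π / 2)) * cosh (bet gam * (π / 2)) - 1 ≠ 0 := by
    nlinarith
  have hk1 : kappa1 lam gam *
      (2 * cosh (alph lam gam * (π / 2)) * cosh (bet gam * (π / 2)) - 1) =
      2 * cosh (alph lam gam * (π / 2)) * sinh (bet gam * (π / 2)) := by
    unfold kappa1
    exact div_mul_cancel₀ _ hden
  have hC0 : cosh (alph lam gam * (π / 2)) ≠ 0 := by positivity
  have hk2 : kappa2 lam gam * alph lam gam * cosh (alph lam gam * (π / 2)) =
      bet gam * kappa1 lam gam := by
    unfold kappa2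
    field_simp
  have hw : wM lam gam = fun x => if x ≤ π / 2 then
      cosh (bet gam * x) - kappa1 lam gam * sinh (bet gam * x)
    else (cosh (bet gam * (π - x)) - kappa1 lam gam * sinh (bet gam * (π - x)))
      - kappa2 lam gam * sinh (alph lam gam * (x - π / 2)) := rfl
  generalize alph lam gam = a at *
  generalize bet gam = b at *
  generalize kappa1 lam gam = k at *
  generalize kappa2 lam gam = m at *
  have hpi : π - π / 2 = π / 2 := by ring
  have hm : 2 * b * (sinh (b * (π / 2)) - k * cosh (b * (π / 2))) = - (m * a) := by
    apply mul_right_cancel₀ hC0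
    linear_combination hk2 - b * hk1
  have hd1 := glue_deriv _ _ _ _ (π / 2) (hd_left b k) (hd_right a b k m)
    (by simp [hpi]) (by simp only [hpi, sub_self, mul_zero, cosh_zero]; linarith)
  have hd2 := glue_deriv _ _ _ _ (π / 2) (hd_left2 b k) (hd_right2 a b k m)
    (by simp only [hpi, sub_self, mul_zero, cosh_zero]; linarith) (by simp [hpi])
  rw [← hw] at hd1
  have hderiv := funext fun x => (hd1 x).deriv
  rw [← hderiv] at hd2
  have hpos := Real.pi_pos
  refine ⟨fun x _ => (hd1 x).continuousAt.continuousWithinAt,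
    fun x _ => ⟨(hd1 x).differentiableAt, (hd2 x).differentiableAt⟩, ?_, ?_, ?_, ?_⟩
  · rw [hw]
    have h0 : (0 : ℝ) ≤ π / 2 := by positivity
    simp only [if_pos h0]
    simp
  · intro x hx
    rw [(hd2 x).deriv, hw]
    simp only [if_pos hx.2.le, hb2]
    ring
  · intro x hx
    have h1 : ¬ x ≤ π / 2 := not_le.mpr hx.1
    have h2 : π - x ≤ π / 2 := by linarith [hx.1]
    rw [(hd2 x).deriv, hw]
    simp only [if_neg h1, if_pos h2, hb2, ha2]
    ring
  · have h := (hd1 π).hasDerivWithinAt (s := Iic π)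
    rw [if_neg (by linarith)] at h
    refine h.congr_deriv ?_
    simp only [hpi, sub_self, mul_zero, sinh_zero, cosh_zero]
    linarith
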